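/- For every probability measure μ on E_{n-1} with 0 < μ(π_{n/n-1}) < ∞ the kernel K_{n,μ} satisfies, for every x_n ∈ S_n, the Doeblin minorization K_{n,μ}(x_n, A) ≥ ε_μ ω_n(μ)(A) for all measurable A, where ε_μ := Z_n μ(π_{n/n-1})/(Z_{n-1} B_n) ∈ (0,1]; consequently, for every x_n ∈ S_n and every integer m ≥ 0, ‖K_{n,μ}^m(x_n, ·) − ω_n(μ)‖_tv ≤ 2(1 − ε_μ)^m. -/

import Mathlib

open MeasureTheory
open scoped ENNReal NNReal

namespace Paper

noncomputable section

/-- Total variation distance: `sup {|∫ f dμ - ∫ f dν| : f measurable, |f| ≤ 1}`. -/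
def tvDist {Z : Type*} [MeasurableSpace Z] (μ ν : Measure Z) : ℝ :=
  ⨆ f : { f : Z → ℝ // Measurable f ∧ ∀ z, |f z| ≤ 1 },
    |(∫ z, f.1 z ∂μ) - ∫ z, f.1 z ∂ν|

/-- `m`-step iterate of a kernel. -/
def iterK {Z : Type*} [MeasurableSpace Z] (K : Z → Measure Z) : ℕ → Z → Measure Z
  | 0 => fun z => Measure.dirac z
  | m + 1 => fun z => (iterK K m z).bind K

/-- Solution of the Poisson equation associated to `K` and `ω`. -/
def poissonSol {Z : Type*} [MeasurableSpace Z] (K : Z → Measure Z) (ω : Measure Z)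
    (f : Z → ℝ) (z : Z) : ℝ :=
  ∑' i : ℕ, ((∫ y, f y ∂(iterK K i z)) - ∫ y, f y ∂ω)

/-- `(δ_{z0} - ω') K'^i (K' - K) K^j (g)`, composed from left to right. -/
def crossTerm {Z : Type*} [MeasurableSpace Z] (K K' : Z → Measure Z) (ω' : Measure Z)
    (g : Z → ℝ) (z0 : Z) (i j : ℕ) : ℝ :=
  (∫ y, ((∫ a, (∫ b, g b ∂(iterK K j a)) ∂(K' y)) -
      ∫ a, (∫ b, g b ∂(iterK K j a)) ∂(K y)) ∂(iterK K' i z0)) -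
    ∫ z, (∫ y, ((∫ a, (∫ b, g b ∂(iterK K j a)) ∂(K' y)) -
      ∫ a, (∫ b, g b ∂(iterK K j a)) ∂(K y)) ∂(iterK K' i z)) ∂ω'

variable {X Y : Type*} [MeasurableSpace X] [MeasurableSpace Y]

/-- The importance weight `w_n`. -/
def weight (γm : X → ℝ≥0∞) (γn q : X × Y → ℝ≥0∞) (p : X × Y) : ℝ≥0∞ :=
  γn p / (γm p.1 * q p)

/-- The Metropolis–Hastings acceptance probability. -/
def accept (w : X × Y → ℝ≥0∞) (p p' : X × Y) : ℝ≥0∞ := min 1 (w p' / w p)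

/-- The proposal distribution `μ × q_n`. -/
def proposal (dxY : Measure Y) (q : X × Y → ℝ≥0∞) (μ : Measure X) : Measure (X × Y) :=
  (μ.prod dxY).withDensity q

/-- The Metropolis–Hastings kernel `K_{n,μ}`. -/
def mhK (dxY : Measure Y) (γm : X → ℝ≥0∞) (γn q : X × Y → ℝ≥0∞) (μ : Measure X)
    (p : X × Y) : Measure (X × Y) :=
  (proposal dxY q μ).withDensity (accept (weight γm γn q) p) +
    (1 - ∫⁻ p', accept (weight γm γn q) p p' ∂(proposal dxY q μ)) • Measure.dirac p

/-- The marginal density `π_n(x_{n-1})`. -/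
def margN (dxY : Measure Y) (γn : X × Y → ℝ≥0∞) (Zn : ℝ≥0∞) (x : X) : ℝ≥0∞ :=
  (∫⁻ y, γn (x, y) ∂dxY) / Zn

/-- The ratio `π_{n/n-1}(x_{n-1}) = π_n(x_{n-1}) / π_{n-1}(x_{n-1})`. -/
def ratioN (dxY : Measure Y) (γm : X → ℝ≥0∞) (γn : X × Y → ℝ≥0∞) (Zm Zn : ℝ≥0∞)
    (x : X) : ℝ≥0∞ :=
  margN dxY γn Zn x / (γm x / Zm)

/-- The conditional density `π̄_n(x_{n-1}, x)`. -/
def condN (dxY : Measure Y) (γn : X × Y → ℝ≥0∞) (Zn : ℝ≥0∞) (p : X × Y) : ℝ≥0∞ :=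
  (γn p / Zn) / margN dxY γn Zn p.1

/-- The invariant distribution `ω_n(μ)`. -/
def omegaN (dxY : Measure Y) (γm : X → ℝ≥0∞) (γn : X × Y → ℝ≥0∞) (Zm Zn : ℝ≥0∞)
    (μ : Measure X) : Measure (X × Y) :=
  (∫⁻ x, ratioN dxY γm γn Zm Zn x ∂μ)⁻¹ •
    (μ.prod dxY).withDensity fun p => ratioN dxY γm γn Zm Zn p.1 * condN dxY γn Zn p

open ProbabilityTheory

/-! ### Doeblin minorization implies geometric ergodicity -/

instance isProbabilityMeasure_iterK {Z : Type*} [MeasurableSpace Z] (κ : Kernel Z Z)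
    [IsMarkovKernel κ] (m : ℕ) (z : Z) : IsProbabilityMeasure (iterK κ m z) := by
  induction m with
  | zero => exact inferInstanceAs (IsProbabilityMeasure (Measure.dirac z))
  | succ m ih =>
    exact inferInstanceAs (IsProbabilityMeasure ((iterK κ m z).bind κ))

lemma integrable_of_forall_mem_Icc {Z : Type*} [MeasurableSpace Z] (ν : Measure Z)
    [IsFiniteMeasure ν] {g : Z → ℝ} (hg : Measurable g) {a b : ℝ}
    (hab : ∀ z, g z ∈ Set.Icc a b) : Integrable g ν :=
  Integrable.of_mem_Icc a b hg.aemeasurable (.of_forall hab)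

lemma integral_mem_Icc {Z : Type*} [MeasurableSpace Z] (ν : Measure Z)
    [IsProbabilityMeasure ν] {g : Z → ℝ} (hg : Measurable g) {a b : ℝ}
    (hab : ∀ z, g z ∈ Set.Icc a b) : ∫ z, g z ∂ν ∈ Set.Icc a b := by
  have hi := integrable_of_forall_mem_Icc ν hg hab
  constructor
  · simpa using integral_mono (integrable_const a) hi fun z => (hab z).1
  · simpa using integral_mono hi (integrable_const b) fun z => (hab z).2

/-- A nonnegative function integrates to at least its integral against a minorizing measure. -/
lemma mul_integral_le_of_minorization {Z : Type*} [MeasurableSpace Z] {ν ω : Measure Z}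
    {ε : ℝ≥0∞} (hle : ε • ω ≤ ν) {g : Z → ℝ} (hg : Integrable g ν) (h0 : ∀ z, 0 ≤ g z) :
    ε.toReal * ∫ z, g z ∂ω ≤ ∫ z, g z ∂ν := by
  rw [← smul_eq_mul, ← integral_smul_measure]
  exact integral_mono_measure hle (.of_forall h0) hg

/-- Under a Doeblin minorization, averaging contracts the range of a function. -/
lemma integral_mem_Icc_of_minorization {Z : Type*} [MeasurableSpace Z] {ν ω : Measure Z}
    [IsProbabilityMeasure ν] [IsProbabilityMeasure ω] {ε : ℝ≥0∞} (hle : ε • ω ≤ ν)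
    {g : Z → ℝ} (hg : Measurable g) {a b : ℝ} (hab : ∀ z, g z ∈ Set.Icc a b) :
    ∫ z, g z ∂ν ∈ Set.Icc (ε.toReal * ∫ z, g z ∂ω + (1 - ε.toReal) * a)
      (ε.toReal * ∫ z, g z ∂ω + (1 - ε.toReal) * b) := by
  have hν := integrable_of_forall_mem_Icc ν hg hab
  have hω := integrable_of_forall_mem_Icc ω hg hab
  have h1 := mul_integral_le_of_minorization hle (hν.sub (integrable_const a))
    fun z => sub_nonneg.2 (hab z).1
  have h2 := mul_integral_le_of_minorization hle ((integrable_const b).sub hν)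
    fun z => sub_nonneg.2 (hab z).2
  simp only [Pi.sub_apply] at h1 h2
  rw [integral_sub hν (integrable_const _), integral_sub hω (integrable_const _)] at h1
  rw [integral_sub (integrable_const _) hν, integral_sub (integrable_const _) hω] at h2
  simp only [integral_const, probReal_univ, one_smul] at h1 h2
  constructor <;> linarith

lemma integral_bind_kernel {Z : Type*} [MeasurableSpace Z] (κ : Kernel Z Z) [IsMarkovKernel κ]
    (ν : Measure Z) [IsProbabilityMeasure ν] {g : Z → ℝ} (hg : Measurable g) {a b : ℝ}
    (hab : ∀ z, g z ∈ Set.Icc a b) :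
    ∫ z, g z ∂(ν.bind κ) = ∫ z, ∫ y, g y ∂(κ z) ∂ν :=
  Kernel.integral_comp (η := κ) (κ := Kernel.const Unit ν) (a := ())
    (integrable_of_forall_mem_Icc ((κ ∘ₖ Kernel.const Unit ν) ()) hg hab)

lemma abs_integral_iterK_sub_le {Z : Type*} [MeasurableSpace Z] (κ : Kernel Z Z)
    [IsMarkovKernel κ] (ω : Measure Z) [IsProbabilityMeasure ω] (hinv : ω.bind κ = ω)
    {ε : ℝ≥0∞} (hmin : ∀ z, ε • ω ≤ κ z) (m : ℕ) (z : Z) :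
    ∀ {g : Z → ℝ} {a b : ℝ}, Measurable g → (∀ z, g z ∈ Set.Icc a b) →
      |(∫ y, g y ∂(iterK κ m z)) - ∫ y, g y ∂ω| ≤ (1 - ε.toReal) ^ m * (b - a) := by
  induction m with
  | zero =>
    intro g a b hg hab
    have h1 : ∫ y, g y ∂(iterK κ 0 z) = g z :=
      integral_dirac' _ _ hg.stronglyMeasurable
    have h2 := integral_mem_Icc ω hg hab
    rw [h1, pow_zero, one_mul]
    exact abs_sub_le_of_le_of_le (hab z).1 (hab z).2 h2.1 h2.2
  | succ m ih =>
    intro g a b hg hab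
    have h1 : ∫ y, g y ∂(iterK κ (m + 1) z) = ∫ x, ∫ y, g y ∂(κ x) ∂(iterK κ m z) :=
      integral_bind_kernel κ (iterK κ m z) hg hab
    have h2 : ∫ y, g y ∂ω = ∫ x, ∫ y, g y ∂(κ x) ∂ω := by
      conv_lhs => rw [← hinv]
      exact integral_bind_kernel κ ω hg hab
    have hmeas : Measurable fun x => ∫ y, g y ∂(κ x) :=
      (hg.stronglyMeasurable.integral_kernel).measurable
    have := ih hmeas fun x => integral_mem_Icc_of_minorization (hmin x) hg hab
    rw [h1, h2]
    refine this.trans (le_of_eq ?_)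
    ring

lemma tvDist_iterK_le {Z : Type*} [MeasurableSpace Z] (κ : Kernel Z Z)
    [IsMarkovKernel κ] (ω : Measure Z) [IsProbabilityMeasure ω] (hinv : ω.bind κ = ω)
    {ε : ℝ≥0∞} (hmin : ∀ z, ε • ω ≤ κ z) (m : ℕ) (z : Z) :
    tvDist (iterK κ m z) ω ≤ 2 * (1 - ε.toReal) ^ m := by
  have : Nonempty { f : Z → ℝ // Measurable f ∧ ∀ z, |f z| ≤ 1 } :=
    ⟨⟨0, measurable_const, by simp⟩⟩
  refine ciSup_le fun f => ?_
  refine (abs_integral_iterK_sub_le κ ω hinv hmin m z f.2.1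
    fun z => abs_le.1 (f.2.2 z)).trans (le_of_eq ?_)
  ring

/-! ### Independence Metropolis–Hastings kernels -/

/-- The Metropolis–Hastings kernel with independent proposal `P` and importance weight `w`. -/
def indepMH (P : Measure (X × Y)) (w : X × Y → ℝ≥0∞) (p : X × Y) : Measure (X × Y) :=
  P.withDensity (accept w p) + (1 - ∫⁻ p', accept w p p' ∂P) • Measure.dirac p

lemma measurable_accept {w : X × Y → ℝ≥0∞} (hw : Measurable w) :
    Measurable (Function.uncurry (accept w)) := by
  unfold accept Function.uncurry
  fun_prop

lemma lintegral_accept_le_one (P : Measure (X × Y)) [IsProbabilityMeasure P]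
    (w : X × Y → ℝ≥0∞) (p : X × Y) : ∫⁻ p', accept w p p' ∂P ≤ 1 :=
  (lintegral_mono fun _ => min_le_left _ _).trans (by simp)

lemma indepMH_apply (P : Measure (X × Y)) (w : X × Y → ℝ≥0∞) (p : X × Y)
    {A : Set (X × Y)} (hA : MeasurableSet A) :
    indepMH P w p A = ∫⁻ p' in A, accept w p p' ∂P +
      (1 - ∫⁻ p', accept w p p' ∂P) * A.indicator 1 p := by
  simp [indepMH, withDensity_apply _ hA, Measure.dirac_apply' _ hA]

/-- `indepMH` as a bundled kernel. -/
def indepMHKernel (P : Measure (X × Y)) [SFinite P] {w : X × Y → ℝ≥0∞} (hw : Measurable w) :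
    Kernel (X × Y) (X × Y) where
  toFun := indepMH P w
  measurable' := by
    refine Measure.measurable_of_measurable_coe _ fun A hA => ?_
    simp_rw [indepMH_apply P w _ hA]
    have ha := measurable_accept hw
    refine .add ha.lintegral_prod_right' (.mul (.sub measurable_const ?_) ?_)
    · exact ha.lintegral_prod_right'
    · exact measurable_one.indicator hA

instance (P : Measure (X × Y)) [IsProbabilityMeasure P] {w : X × Y → ℝ≥0∞}
    (hw : Measurable w) : IsMarkovKernel (indepMHKernel P hw) where
  isProbabilityMeasure p := ⟨by
    change indepMH P w p Set.univ = 1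
    rw [indepMH_apply P w p .univ]
    simpa using add_tsub_cancel_of_le (lintegral_accept_le_one P w p)⟩

lemma div_le_accept {S T : Type*} {w : S × T → ℝ≥0∞} {B : ℝ≥0∞} (hB : ∀ p, w p ≤ B) (p p' : S × T) :
    w p' / B ≤ accept w p p' :=
  le_min (ENNReal.div_le_of_le_mul (by simpa using hB p')) (ENNReal.div_le_div_left (hB p) _)

lemma smul_withDensity_le_indepMH (P : Measure (X × Y)) {w : X × Y → ℝ≥0∞}
    (hw : Measurable w) {B : ℝ≥0∞} (hB : ∀ p, w p ≤ B) (p : X × Y) :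
    B⁻¹ • P.withDensity w ≤ indepMH P w p := by
  rw [← withDensity_smul _ hw]
  refine le_trans (withDensity_mono (.of_forall fun p' => ?_)) (Measure.le_add_right le_rfl)
  simpa [div_eq_mul_inv, mul_comm] using div_le_accept hB p p'

lemma mul_accept {S T : Type*} {w : S × T → ℝ≥0∞} (hw : ∀ p, w p ≠ ⊤) (p p' : S × T) :
    w p * accept w p p' = min (w p) (w p') := by
  rcases eq_or_ne (w p) 0 with h | h
  · simp [h]
  · rw [accept, mul_min, mul_one, ENNReal.mul_div_cancel h (hw p)]

/-- The target measure is invariant. -/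
lemma withDensity_bind_indepMHKernel (P : Measure (X × Y)) [IsProbabilityMeasure P]
    {w : X × Y → ℝ≥0∞} (hw : Measurable w) (hfin : ∀ p, w p ≠ ⊤) :
    (P.withDensity w).bind (indepMHKernel P hw) = P.withDensity w := by
  have ha := measurable_accept hw
  have hmin : Measurable fun r : (X × Y) × X × Y => min (w r.1) (w r.2) := by fun_prop
  ext A hA
  rw [Measure.bind_apply hA (Kernel.aemeasurable _),
    lintegral_withDensity_eq_lintegral_mul _ hw (Kernel.measurable_coe _ hA),
    withDensity_apply _ hA]
  have hsplit : ∀ p, (w * fun p => indepMHKernel P hw p A) p =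
      ∫⁻ p' in A, min (w p) (w p') ∂P +
        A.indicator (fun p => w p * (1 - ∫⁻ p', accept w p p' ∂P)) p := by
    intro p
    change w p * indepMH P w p A = _
    rw [indepMH_apply P w p hA, mul_add, ← lintegral_const_mul _ (ha.of_uncurry_left)]
    simp_rw [mul_accept hfin]
    by_cases hp : p ∈ A <;> simp [hp]
  have hacc : Measurable fun p => ∫⁻ p', accept w p p' ∂P := ha.lintegral_prod_right'
  simp_rw [hsplit]
  have hrej : Measurable fun p => w p * (1 - ∫⁻ p', accept w p p' ∂P) :=
    hw.mul (measurable_const.sub hacc)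
  rw [lintegral_add_right _ (hrej.indicator hA), lintegral_indicator hA,
    lintegral_lintegral_swap hmin.aemeasurable, ← lintegral_add_right _ hrej]
  refine lintegral_congr fun p => ?_
  simp_rw [min_comm _ (w p), ← mul_accept hfin p]
  rw [lintegral_const_mul _ (ha.of_uncurry_left), ← mul_add,
    add_tsub_cancel_of_le (lintegral_accept_le_one P w p), mul_one]

lemma bind_smul_left {Z : Type*} [MeasurableSpace Z] (κ : Kernel Z Z) (ν : Measure Z)
    (c : ℝ≥0∞) : (c • ν).bind κ = c • ν.bind κ := by
  ext A hA
  simp [Measure.bind_apply hA (Kernel.aemeasurable _)]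

/-! ### The proposal and the target in terms of the importance weight -/

lemma isProbabilityMeasure_proposal (dxY : Measure Y) [SigmaFinite dxY] {q : X × Y → ℝ≥0∞}
    (hq : Measurable q) (hqdens : ∀ x, ∫⁻ y, q (x, y) ∂dxY = 1) (μ : Measure X)
    [IsProbabilityMeasure μ] : IsProbabilityMeasure (proposal dxY q μ) := by
  constructor
  rw [proposal, withDensity_apply _ .univ, Measure.restrict_univ,
    lintegral_prod _ hq.aemeasurable]
  simp [hqdens]

lemma measurable_weight {γm : X → ℝ≥0∞} {γn q : X × Y → ℝ≥0∞} (hγm : Measurable γm)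
    (hγn : Measurable γn) (hq : Measurable q) : Measurable (weight γm γn q) := by
  unfold weight
  fun_prop

lemma measurable_margN (dxY : Measure Y) [SigmaFinite dxY] {γn : X × Y → ℝ≥0∞}
    (hγn : Measurable γn) (Zn : ℝ≥0∞) : Measurable (margN dxY γn Zn) :=
  hγn.lintegral_prod_right'.div_const _

lemma ratioN_mul_lintegral_condN (dxY : Measure Y) {γm : X → ℝ≥0∞}
    {γn : X × Y → ℝ≥0∞} (hγn : Measurable γn) (Zm Zn : ℝ≥0∞) {x : X}
    (hx : margN dxY γn Zn x ≠ ⊤) :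
    ∫⁻ y, ratioN dxY γm γn Zm Zn x * condN dxY γn Zn (x, y) ∂dxY =
      ratioN dxY γm γn Zm Zn x := by
  have hγx : Measurable fun y => γn (x, y) := hγn.comp measurable_prodMk_left
  have hcond : Measurable fun y => condN dxY γn Zn (x, y) := by
    unfold condN
    exact (hγx.div_const Zn).div_const (margN dxY γn Zn x)
  rw [lintegral_const_mul _ hcond]
  rcases eq_or_ne (margN dxY γn Zn x) 0 with h | h
  · simp [ratioN, h]
  · have : ∫⁻ y, condN dxY γn Zn (x, y) ∂dxY = 1 := by
      simp only [condN, div_eq_mul_inv]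
      rw [lintegral_mul_const _ (hγx.mul_const _), lintegral_mul_const _ hγx, ← div_eq_mul_inv,
        ← div_eq_mul_inv]
      exact ENNReal.div_self h hx
    rw [this, mul_one]

lemma ratioN_mul_condN {S : Type*} (dxY : Measure Y) {γm : S → ℝ≥0∞} (hγmfin : ∀ x, γm x ≠ ⊤)
    {γn q : S × Y → ℝ≥0∞} (Zm Zn : ℝ≥0∞)
    {p : S × Y} (hpos : γm p.1 = 0 → γn p = 0) (hqpos : 0 < q p) (hqfin : q p ≠ ⊤)
    (h0 : margN dxY γn Zn p.1 = 0 → γn p = 0) (ht : margN dxY γn Zn p.1 ≠ ⊤) :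
    ratioN dxY γm γn Zm Zn p.1 * condN dxY γn Zn p =
      Zm / Zn * (q p * weight γm γn q p) := by
  rcases eq_or_ne (γn p) 0 with hγ | hγ
  · simp [condN, weight, hγ]
  have hm0 : margN dxY γn Zn p.1 ≠ 0 := mt h0 hγ
  have hg0 : γm p.1 ≠ 0 := mt hpos hγ
  rw [ratioN, condN, weight]
  have hgfin : γm p.1 ≠ ⊤ := hγmfin p.1
  generalize margN dxY γn Zn p.1 = M at *
  generalize γm p.1 = g at *
  simp only [div_eq_mul_inv]
  rw [ENNReal.mul_inv (.inl hg0) (.inl hgfin), ENNReal.mul_inv (.inl hg0) (.inl hgfin), inv_inv]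
  calc M * (g⁻¹ * Zm) * (γn p * Zn⁻¹ * M⁻¹)
      = M * M⁻¹ * (g⁻¹ * Zm * γn p * Zn⁻¹) := by ring
    _ = q p * (q p)⁻¹ * (g⁻¹ * Zm * γn p * Zn⁻¹) := by
      rw [ENNReal.mul_inv_cancel hm0 ht, ENNReal.mul_inv_cancel hqpos.ne' hqfin]
    _ = _ := by ring

theorem statement2
    (dxm : Measure X) [SigmaFinite dxm] (dxY : Measure Y) [SigmaFinite dxY]
    (γm : X → ℝ≥0∞) (γn q : X × Y → ℝ≥0∞)
    (hγm : Measurable γm) (hγmfin : ∀ x, γm x ≠ ⊤)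
    (hγn : Measurable γn) (hγnfin : ∀ p, γn p ≠ ⊤)
    (Zm Zn : ℝ≥0∞)
    (hZm : Zm = ∫⁻ x, γm x ∂dxm) (hZm0 : 0 < Zm) (hZmt : Zm ≠ ⊤)
    (hZn : Zn = ∫⁻ p, γn p ∂(dxm.prod dxY)) (hZn0 : 0 < Zn) (hZnt : Zn ≠ ⊤)
    (hq : Measurable q) (hqpos : ∀ p, 0 < q p) (hqfin : ∀ p, q p ≠ ⊤)
    (hqdens : ∀ x, ∫⁻ y, q (x, y) ∂dxY = 1)
    (B : ℝ≥0∞) (hBt : B ≠ ⊤)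
    (hA1 : ∀ p : X × Y, 0 < γn p / Zn → weight γm γn q p ≤ B)
    (μ : Measure X) [IsProbabilityMeasure μ]
    (hμ0 : 0 < ∫⁻ x, ratioN dxY γm γn Zm Zn x ∂μ)
    (hμt : (∫⁻ x, ratioN dxY γm γn Zm Zn x ∂μ) ≠ ⊤) :
    (0 < Zn * (∫⁻ x, ratioN dxY γm γn Zm Zn x ∂μ) / (Zm * B) ∧
        Zn * (∫⁻ x, ratioN dxY γm γn Zm Zn x ∂μ) / (Zm * B) ≤ 1) ∧
      ∀ p : X × Y, 0 < γn p / Zn →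
        (∀ A : Set (X × Y), MeasurableSet A →
          Zn * (∫⁻ x, ratioN dxY γm γn Zm Zn x ∂μ) / (Zm * B) *
              omegaN dxY γm γn Zm Zn μ A ≤ mhK dxY γm γn q μ p A) ∧
        ∀ m : ℕ,
          tvDist (iterK (mhK dxY γm γn q μ) m p) (omegaN dxY γm γn Zm Zn μ) ≤
            2 * (1 - (Zn * (∫⁻ x, ratioN dxY γm γn Zm Zn x ∂μ) / (Zm * B)).toReal) ^ m := by
  have hP := isProbabilityMeasure_proposal dxY hq hqdens μ
  have hw : Measurable (weight γm γn q) := measurable_weight hγm hγn hq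
  have hγpos : ∀ p, γn p ≠ 0 → 0 < γn p / Zn := fun p hp => ENNReal.div_pos hp hZnt
  have hwB : ∀ p, weight γm γn q p ≤ B := by
    intro p
    rcases eq_or_ne (γn p) 0 with h | h
    · simp [weight, h]
    · exact hA1 p (hγpos p h)
  have hwfin : ∀ p, weight γm γn q p ≠ ⊤ := fun p => ne_top_of_le_ne_top hBt (hwB p)
  have hγ0 : ∀ p : X × Y, γm p.1 = 0 → γn p = 0 := by
    intro p h
    by_contra h'
    exact hwfin p (by simp [weight, h, ENNReal.div_zero h'])
  have hγle : ∀ p : X × Y, γn p ≤ B * γm p.1 * q p := by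
    intro p
    rcases eq_or_ne (γm p.1) 0 with h | h
    · simp [hγ0 p h]
    · rw [mul_assoc, ← ENNReal.div_le_iff (mul_ne_zero h (hqpos p).ne')
        (ENNReal.mul_ne_top (hγmfin _) (hqfin p))]
      exact hwB p
  have hγx : ∀ x, Measurable fun y => γn (x, y) := fun x => hγn.comp measurable_prodMk_left
  have hqx : ∀ x, Measurable fun y => q (x, y) := fun x => hq.comp measurable_prodMk_left
  have hMt : ∀ x, margN dxY γn Zn x ≠ ⊤ := by
    intro x
    refine ENNReal.div_ne_top (ne_top_of_le_ne_top ?_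
      (lintegral_mono fun y => hγle (x, y))) hZn0.ne'
    dsimp only
    rw [lintegral_const_mul _ (hqx x), hqdens, mul_one]
    exact ENNReal.mul_ne_top hBt (hγmfin x)
  have hM := measurable_margN dxY hγn Zn
  have hae : ∀ᵐ p ∂(μ.prod dxY), margN dxY γn Zn p.1 = 0 → γn p = 0 := by
    refine (Measure.ae_prod_iff_ae_ae ?_).2 (.of_forall fun x => ?_)
    · exact ((measurableSet_eq_fun (hM.comp measurable_fst) measurable_const).imp
        (measurableSet_eq_fun hγn measurable_const))
    · by_cases hx : margN dxY γn Zn x = 0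
      · have : ∫⁻ y, γn (x, y) ∂dxY = 0 := by
          simpa [margN, hZnt] using hx
        rw [lintegral_eq_zero_iff (hγx x)] at this
        filter_upwards [this] with y hy _ using hy
      · exact .of_forall fun y h => absurd h hx
  have hdens : (μ.prod dxY).withDensity
      (fun p => ratioN dxY γm γn Zm Zn p.1 * condN dxY γn Zn p) =
      (Zm / Zn) • (proposal dxY q μ).withDensity (weight γm γn q) := by
    rw [proposal, ← withDensity_mul _ hq hw, ← withDensity_smul _ (hq.mul hw)]
    refine withDensity_congr_ae ?_
    filter_upwards [hae] with p hp
    exact ratioN_mul_condN dxY hγmfin Zm Zn (hγ0 p) (hqpos p) (hqfin p) hp (hMt _)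
  have hc : ∫⁻ x, ratioN dxY γm γn Zm Zn x ∂μ =
      Zm / Zn * ∫⁻ p, weight γm γn q p ∂(proposal dxY q μ) := by
    have hmeas : Measurable fun p : X × Y =>
        ratioN dxY γm γn Zm Zn p.1 * condN dxY γn Zn p :=
      ((hM.comp measurable_fst).div ((hγm.comp measurable_fst).div_const _)).mul
        ((hγn.div_const _).div (hM.comp measurable_fst))
    have h := congrArg (fun ν => ν Set.univ) hdens
    simp only [Measure.smul_apply, withDensity_apply _ MeasurableSet.univ,
      Measure.restrict_univ, smul_eq_mul] at h
    rw [← h, lintegral_prod _ hmeas.aemeasurable]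
    exact lintegral_congr fun x => (ratioN_mul_lintegral_condN dxY hγn Zm Zn (hMt x)).symm
  set P := proposal dxY q μ
  set w := weight γm γn q
  set W := ∫⁻ p, w p ∂P with hW
  have hs0 : Zm / Zn ≠ 0 := (ENNReal.div_pos hZm0.ne' hZnt).ne'
  have hst : Zm / Zn ≠ ⊤ := ENNReal.div_ne_top hZmt hZn0.ne'
  have hW0 : W ≠ 0 := by
    rintro h
    simp [hc, h] at hμ0
  have hWB : W ≤ B := (lintegral_mono hwB).trans (by simp)
  have hWt : W ≠ ⊤ := ne_top_of_le_ne_top hBt hWB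
  have hB0 : B ≠ 0 := fun h => hW0 (by simpa [h] using hWB)
  have hε : Zn * (∫⁻ x, ratioN dxY γm γn Zm Zn x ∂μ) / (Zm * B) = W / B := by
    rw [hc]
    simp only [div_eq_mul_inv]
    rw [ENNReal.mul_inv (.inl hZm0.ne') (.inl hZmt)]
    calc Zn * (Zm * Zn⁻¹ * W) * (Zm⁻¹ * B⁻¹) = (Zn * Zn⁻¹) * (Zm * Zm⁻¹) * (W * B⁻¹) := by ring
      _ = W * B⁻¹ := by
        rw [ENNReal.mul_inv_cancel hZn0.ne' hZnt, ENNReal.mul_inv_cancel hZm0.ne' hZmt,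
          one_mul, one_mul]
  have hω : omegaN dxY γm γn Zm Zn μ = W⁻¹ • P.withDensity w := by
    rw [omegaN, hdens, hc, smul_smul, ENNReal.mul_inv (.inl hs0) (.inl hst)]
    congr 1
    rw [mul_right_comm, ENNReal.inv_mul_cancel hs0 hst, one_mul]
  rw [hε, hω]
  have hωP : IsProbabilityMeasure (W⁻¹ • P.withDensity w) := by
    constructor
    simp [withDensity_apply _ MeasurableSet.univ, ← hW, ENNReal.inv_mul_cancel hW0 hWt]
  have hmin : ∀ p, (W / B) • (W⁻¹ • P.withDensity w) ≤ indepMHKernel P hw p := by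
    intro p
    rw [smul_smul, div_eq_mul_inv, mul_right_comm, ENNReal.mul_inv_cancel hW0 hWt, one_mul]
    exact smul_withDensity_le_indepMH P hw hwB p
  refine ⟨⟨ENNReal.div_pos hW0 hBt, ENNReal.div_le_of_le_mul (by simpa using hWB)⟩,
    fun p _ => ⟨fun A _ => hmin p A, fun m => ?_⟩⟩
  refine tvDist_iterK_le (indepMHKernel P hw) _ ?_ hmin m p
  rw [bind_smul_left, withDensity_bind_indepMHKernel P hw hwfin]

end

end Paper
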